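/- Let q ∈ ℕ, q ≥ 1, s ∈ ℝ, and set σ := q(1+s) − 1. Let (φ_n)_{n≥0} ⊂ ℂ and let u_{j,n} := ((n+qj)!/(n!·j!)) φ_{n+qj} for j, n ∈ ℕ, so that û(t,z) = Σ_{j,n} u_{j,n} t^j z^n is the unique formal power series solution of ∂_t û = ∂_z^q û with û(0,z) = Σ_n φ_n z^n. Then the following are equivalent: (1) there exist C, A > 0 with |φ_n| ≤ C A^n Γ_s(n) for all n (i.e. û(0,z) has Gevrey order s); (2) there exist C, A > 0 with |u_{j,j'}| ≤ C A^j Γ_σ(j) for all j ∈ ℕ and all j' ∈ {0,…,q−1} (i.e. the traces ∂_z^{j'}û(t,0), j' = 0,…,q−1, have Gevrey order σ = q(1+s)−1); (3) there exist C, A > 0 with |u_{j,n}| ≤ C A^{j+n} Γ_σ(j) Γ_s(n) for all j, n ∈ ℕ (i.e. û has Gevrey order (q(1+s)−1, s) in (t,z)). -/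

import Mathlib

/-- `Γ_s(n) := Γ(1+sn)` for `s ≥ 0` and `Γ_s(n) := 1/Γ(1-sn)` for `s < 0`. -/
noncomputable def GammaS (s : ℝ) (n : ℕ) : ℝ :=
  if 0 ≤ s then Real.Gamma (1 + s * n) else (Real.Gamma (1 - s * n))⁻¹

open Real MeasureTheory

/-- Upper half of a crude Stirling estimate for the real Gamma function. -/
lemma Gamma_one_add_le {x : ℝ} (hx : 0 < x) :
    Gamma (1 + x) ≤ 2 * exp (x * log (2 * x)) := by
  have hint : IntegrableOn (fun t : ℝ => exp (-(1 / 2 * t))) (Set.Ioi 0) := by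
    have := integrableOn_exp_mul_Ioi (a := -(1 / 2 : ℝ)) (by norm_num) 0
    simpa [neg_mul] using this
  have hval : ∫ t in Set.Ioi (0 : ℝ), exp (-(1 / 2 * t)) = 2 := by
    have := integral_exp_mul_Ioi (a := -(1 / 2 : ℝ)) (by norm_num) 0
    simpa [neg_mul] using this
  rw [Gamma_eq_integral (by linarith), mul_comm, ← hval, ← integral_const_mul, hval]
  refine setIntegral_mono_on (GammaIntegral_convergent (by linarith)) (hint.const_mul _)
    measurableSet_Ioi fun t ht => ?_
  have ht : 0 < t := ht
  rw [add_sub_cancel_left, rpow_def_of_pos ht, ← exp_add, ← exp_add, exp_le_exp]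
  have h := log_le_sub_one_of_pos (show 0 < t / (2 * x) by positivity)
  rw [log_div ht.ne' (by positivity)] at h
  have h' := mul_le_mul_of_nonneg_left h hx.le
  have e : x * (t / (2 * x) - 1) = t / 2 - x := by field_simp
  rw [e] at h'
  linarith

/-- Lower half of a crude Stirling estimate for the real Gamma function. -/
lemma le_Gamma_one_add {x : ℝ} (hx : 0 < x) :
    exp (x * log x - x) ≤ Gamma (1 + x) := by
  have hint : IntegrableOn (fun t : ℝ => exp (-t)) (Set.Ioi x) := integrableOn_exp_neg_Ioi x
  have hconv := GammaIntegral_convergent (show 0 < 1 + x by linarith)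
  have hsub : Set.Ioi x ⊆ Set.Ioi 0 := Set.Ioi_subset_Ioi hx.le
  calc exp (x * log x - x) = ∫ t in Set.Ioi x, exp (x * log x) * exp (-t) := by
        rw [integral_const_mul, integral_exp_neg_Ioi, ← exp_add, sub_eq_add_neg]
    _ ≤ ∫ t in Set.Ioi x, exp (-t) * t ^ (1 + x - 1) := by
        refine setIntegral_mono_on (hint.const_mul _) (hconv.mono_set hsub)
          measurableSet_Ioi fun t ht => ?_
        have ht : x < t := ht
        rw [add_sub_cancel_left, rpow_def_of_pos (hx.trans ht), mul_comm, mul_comm x]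
        gcongr
    _ ≤ ∫ t in Set.Ioi 0, exp (-t) * t ^ (1 + x - 1) := by
        refine setIntegral_mono_set hconv ?_ hsub.eventuallyLE
        refine (ae_restrict_iff' measurableSet_Ioi).2 (.of_forall fun t ht => ?_)
        have ht : 0 < t := ht
        simp only [Pi.zero_apply]
        positivity
    _ = Gamma (1 + x) := (Gamma_eq_integral (by linarith)).symm

lemma abs_log_Gamma_one_add_sub_le {x : ℝ} (hx : 0 < x) :
    |log (Gamma (1 + x)) - x * log x| ≤ x + 1 := by
  have hpos : 0 < Gamma (1 + x) := Gamma_pos_of_pos (by linarith)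
  have hl := (le_log_iff_exp_le hpos).2 (le_Gamma_one_add hx)
  have hu := log_le_log hpos (Gamma_one_add_le hx)
  rw [log_mul two_ne_zero (exp_ne_zero _), log_exp, log_mul two_ne_zero hx.ne'] at hu
  have h2 : log 2 < 1 := log_two_lt_d9.trans (by norm_num)
  rw [abs_le]
  constructor
  · linarith
  · nlinarith

lemma GammaS_pos (s : ℝ) (n : ℕ) : 0 < GammaS s n := by
  have hn : (0 : ℝ) ≤ n := n.cast_nonneg
  unfold GammaS
  split_ifs with hs
  · exact Gamma_pos_of_pos (by positivity)
  · exact inv_pos.2 (Gamma_pos_of_pos (by nlinarith))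

lemma log_GammaS_neg (s : ℝ) (n : ℕ) : log (GammaS (-s) n) = -log (GammaS s n) := by
  unfold GammaS
  rcases lt_trichotomy s 0 with hs | rfl | hs
  · rw [if_pos (by linarith), if_neg (by linarith), log_inv, neg_neg, sub_eq_add_neg, neg_mul]
  · simp
  · rw [if_neg (by linarith), if_pos hs.le, log_inv, neg_mul, sub_neg_eq_add]

lemma abs_log_GammaS_sub_le_of_pos {s : ℝ} (hs : 0 < s) :
    ∃ K, 0 ≤ K ∧ ∀ n : ℕ, |log (GammaS s n) - s * log n.factorial| ≤ K * (n + 1) := by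
  refine ⟨2 * s + s * |log s| + 1, by positivity, fun n => ?_⟩
  rcases n.eq_zero_or_pos with rfl | hn
  · simp [GammaS, hs.le]
    positivity
  have hn : (0 : ℝ) < n := Nat.cast_pos.2 hn
  have h₁ := abs_log_Gamma_one_add_sub_le (mul_pos hs hn)
  have h₂ := abs_log_Gamma_one_add_sub_le hn
  rw [add_comm 1 (n : ℝ), Gamma_nat_eq_factorial] at h₂
  rw [log_mul hs.ne' hn.ne'] at h₁
  have h₃ : |s * (log n.factorial - n * log n)| ≤ s * (n + 1) := by
    rw [abs_mul, abs_of_pos hs]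
    gcongr
  have h₄ : |s * n * log s| ≤ s * n * |log s| := by
    rw [abs_mul, abs_of_pos (by positivity)]
  have h₅ : 0 ≤ s * |log s| := by positivity
  rw [GammaS, if_pos hs.le]
  rw [abs_le] at *
  constructor <;> nlinarith

/-- `Γ_s(n)` and `(n!)^s` agree up to geometric factors. -/
lemma abs_log_GammaS_sub_le (s : ℝ) :
    ∃ K, 0 ≤ K ∧ ∀ n : ℕ, |log (GammaS s n) - s * log n.factorial| ≤ K * (n + 1) := by
  rcases lt_trichotomy s 0 with hs | rfl | hs
  · obtain ⟨K, hK, h⟩ := abs_log_GammaS_sub_le_of_pos (neg_pos.2 hs)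
    refine ⟨K, hK, fun n => ?_⟩
    rw [← abs_neg]
    convert h n using 2
    rw [log_GammaS_neg]
    ring
  · exact ⟨0, le_rfl, fun n => by simp [GammaS]⟩
  · exact abs_log_GammaS_sub_le_of_pos hs

lemma abs_log_factorial_add_sub_le (a b : ℕ) :
    |log (a + b).factorial - log a.factorial - log b.factorial| ≤ a + b := by
  have hc : 0 < (a + b).choose b := Nat.choose_pos (Nat.le_add_left b a)
  have hc' : (((a + b).choose b : ℕ) : ℝ) ≤ 2 ^ (a + b) := by
    exact_mod_cast Nat.choose_le_two_pow _ _
  have h : (((a + b).factorial : ℕ) : ℝ) =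
      (a + b).choose b * a.factorial * b.factorial := by
    exact_mod_cast (Nat.add_choose_mul_factorial_mul_factorial a b).symm
  have hlog := log_le_log (Nat.cast_pos.2 hc) hc'
  have hnonneg : 0 ≤ log ((a + b).choose b : ℝ) := log_natCast_nonneg _
  have h2 : log 2 < 1 := log_two_lt_d9.trans (by norm_num)
  rw [log_pow] at hlog
  push_cast at hlog
  have hab : (0 : ℝ) ≤ a + b := by positivity
  rw [h, log_mul (by positivity) (by positivity), log_mul (by positivity) (by positivity),
    abs_le]
  constructor <;> nlinarith

/-- `(n+qj)!` and `n! (j!)^q` agree up to geometric factors. -/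
lemma abs_log_factorial_add_mul_sub_le (q : ℕ) :
    ∃ K : ℝ, 0 ≤ K ∧ ∀ n j : ℕ,
      |log (n + q * j).factorial - log n.factorial - q * log j.factorial| ≤ K * (n + j) := by
  induction q with
  | zero => exact ⟨0, le_rfl, fun n j => by simp⟩
  | succ q ih =>
    obtain ⟨K, hK, h⟩ := ih
    refine ⟨K + (q + 1), by positivity, fun n j => ?_⟩
    have h₁ := h n j
    have h₂ := abs_log_factorial_add_sub_le (n + q * j) j
    rw [show n + (q + 1) * j = n + q * j + j by ring]
    push_cast at h₂ ⊢
    have h₃ : (0 : ℝ) ≤ q * n := by positivity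
    rw [abs_le] at *
    constructor <;> nlinarith

/-- Passage between a geometric bound relative to `g` and an exponential bound relative to a
logarithmic weight `G` that agrees with `log g` up to a linear error. -/
lemma exists_geometric_bound_iff {ι : Type*} (a g G : ι → ℝ) (w : ι → ℕ) (hg : ∀ i, 0 < g i)
    {K₀ : ℝ} (hG : ∀ i, |log (g i) - G i| ≤ K₀ * (w i + 1)) :
    (∃ C > (0 : ℝ), ∃ A > (0 : ℝ), ∀ i, a i ≤ C * A ^ w i * g i) ↔
      ∃ K : ℝ, 0 ≤ K ∧ ∀ i, a i ≤ exp (K * (w i + 1) + G i) := by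
  constructor
  · rintro ⟨C, hC, A, hA, h⟩
    refine ⟨|log C| + |log A| + |K₀|, by positivity, fun i => (h i).trans ?_⟩
    have hw : (0 : ℝ) ≤ w i := (w i).cast_nonneg
    rw [← log_le_iff_le_exp (mul_pos (by positivity) (hg i)),
      log_mul (by positivity) (hg i).ne', log_mul hC.ne' (by positivity), log_pow]
    have h₁ := (abs_le.1 (hG i)).2
    have h₂ := le_abs_self (log C)
    have h₃ : w i * log A ≤ w i * |log A| := by gcongr; exact le_abs_self _
    have h₄ : K₀ * (w i + 1) ≤ |K₀| * (w i + 1) := by gcongr; exact le_abs_self _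
    nlinarith [abs_nonneg (log A), mul_nonneg hw (abs_nonneg (log C))]
  · rintro ⟨K, -, h⟩
    refine ⟨exp (K + K₀), exp_pos _, exp (K + K₀), exp_pos _, fun i => (h i).trans ?_⟩
    rw [← exp_nat_mul, ← exp_add]
    have hexp : exp (log (g i)) = g i := exp_log (hg i)
    rw [← hexp, ← exp_add, exp_le_exp]
    have h₁ := (abs_le.1 (hG i)).1
    linarith

/-- For the formal solution `û(t,z) = Σ u_{j,n} t^j z^n`,
`u_{j,n} = ((n+qj)!/(n!·j!)) φ_{n+qj}`, of `∂_t û = ∂_z^q û`, `û(0,z) = Σ φ_n z^n`,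
the following are equivalent: the Cauchy datum has Gevrey order `s`; the traces
`∂_z^{j'} û(t,0)`, `j' < q`, have Gevrey order `σ = q(1+s)-1`; `û` has Gevrey
order `(σ, s)` in `(t,z)`. -/
theorem stmt8 (q : ℕ) (hq : 1 ≤ q) (s : ℝ) (φ : ℕ → ℂ) (u : ℕ → ℕ → ℂ)
    (hu : ∀ j n : ℕ, u j n =
      ((Nat.factorial (n + q * j) : ℂ) /
        ((Nat.factorial n : ℂ) * (Nat.factorial j : ℂ))) * φ (n + q * j)) :
    ((∃ C > (0:ℝ), ∃ A > (0:ℝ), ∀ n : ℕ, ‖φ n‖ ≤ C * A ^ n * GammaS s n) ↔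
      (∃ C > (0:ℝ), ∃ A > (0:ℝ), ∀ j : ℕ, ∀ j' < q,
        ‖u j j'‖ ≤ C * A ^ j * GammaS ((q : ℝ) * (1 + s) - 1) j)) ∧
    ((∃ C > (0:ℝ), ∃ A > (0:ℝ), ∀ j : ℕ, ∀ j' < q,
        ‖u j j'‖ ≤ C * A ^ j * GammaS ((q : ℝ) * (1 + s) - 1) j) ↔
      (∃ C > (0:ℝ), ∃ A > (0:ℝ), ∀ j n : ℕ,
        ‖u j n‖ ≤ C * A ^ (j + n) * GammaS ((q : ℝ) * (1 + s) - 1) j * GammaS s n)) := by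
  have hnorm : ∀ j n, ‖u j n‖ = exp (log (n + q * j).factorial - log n.factorial
      - log j.factorial) * ‖φ (n + q * j)‖ := fun j n => by
    rw [hu, norm_mul, norm_div, norm_mul, exp_sub, exp_sub, exp_log (by positivity),
      exp_log (by positivity), exp_log (by positivity), div_div]
    simp only [Complex.norm_natCast]
  set σ : ℝ := q * (1 + s) - 1 with hσ
  obtain ⟨Ks, hKs, hs⟩ := abs_log_GammaS_sub_le s
  obtain ⟨Kσ, hKσ, hσs⟩ := abs_log_GammaS_sub_le σ
  obtain ⟨D, hD, hfact⟩ := abs_log_factorial_add_mul_sub_le q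
  have hfact' : ∀ n j : ℕ, |(1 + s) * (log (n + q * j).factorial - log n.factorial
      - q * log j.factorial)| ≤ |1 + s| * D * (n + j) := fun n j => by
    rw [abs_mul, mul_assoc]
    exact mul_le_mul_of_nonneg_left (hfact n j) (abs_nonneg _)
  have hdatum := exists_geometric_bound_iff (fun n => ‖φ n‖) (GammaS s)
    (fun n => s * log n.factorial) (fun n => n) (GammaS_pos s) hs
  have htrace := exists_geometric_bound_iff (fun p : ℕ × Fin q => ‖u p.1 p.2‖)
    (fun p => GammaS σ p.1) (fun p => σ * log p.1.factorial) (fun p => p.1)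
    (fun p => GammaS_pos σ p.1) (fun p => hσs p.1)
  have hsolution := exists_geometric_bound_iff (fun p : ℕ × ℕ => ‖u p.1 p.2‖)
    (fun p => GammaS σ p.1 * GammaS s p.2)
    (fun p => σ * log p.1.factorial + s * log p.2.factorial) (fun p => p.1 + p.2)
    (fun p => mul_pos (GammaS_pos σ p.1) (GammaS_pos s p.2)) (K₀ := Ks + Kσ) (fun p => by
      have h₁ := hs p.2
      have h₂ := hσs p.1
      rw [log_mul (GammaS_pos σ p.1).ne' (GammaS_pos s p.2).ne']
      push_cast
      have h₃ : 0 ≤ Ks * p.1 := by positivity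
      have h₄ : 0 ≤ Kσ * p.2 := by positivity
      rw [abs_le] at *
      constructor <;> linarith)
  simp only [Prod.forall, Fin.forall_iff, ← mul_assoc] at htrace hsolution
  rw [hdatum, htrace, hsolution]
  have datum_to_solution : (∃ K : ℝ, 0 ≤ K ∧ ∀ n : ℕ,
      ‖φ n‖ ≤ exp (K * (n + 1) + s * log n.factorial)) →
      ∃ K : ℝ, 0 ≤ K ∧ ∀ j n : ℕ, ‖u j n‖ ≤
        exp (K * ((j + n : ℕ) + 1) + (σ * log j.factorial + s * log n.factorial)) := by
    rintro ⟨K, hK, h⟩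
    refine ⟨K * (q + 1) + |1 + s| * D, by positivity, fun j n => ?_⟩
    rw [hnorm]
    refine (mul_le_mul_of_nonneg_left (h _) (exp_pos _).le).trans ?_
    rw [← exp_add, exp_le_exp, hσ]
    have h₁ := (abs_le.1 (hfact' n j)).2
    have h₂ : 0 ≤ |1 + s| * D := by positivity
    have h₃ : 0 ≤ K * (q * n + q + j) := by positivity
    push_cast
    linarith
  have solution_to_trace : (∃ K : ℝ, 0 ≤ K ∧ ∀ j n : ℕ, ‖u j n‖ ≤
        exp (K * ((j + n : ℕ) + 1) + (σ * log j.factorial + s * log n.factorial))) →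
      ∃ K : ℝ, 0 ≤ K ∧ ∀ j j' : ℕ, j' < q →
        ‖u j j'‖ ≤ exp (K * (j + 1) + σ * log j.factorial) := by
    rintro ⟨K, hK, h⟩
    have hq0 : 0 ≤ log (q.factorial : ℝ) := log_natCast_nonneg _
    refine ⟨K * (q + 1) + |s| * log q.factorial, by positivity,
      fun j j' hj' => (h j j').trans ?_⟩
    have h₁ : s * log j'.factorial ≤ |s| * log q.factorial := by
      refine mul_le_mul (le_abs_self s) ?_ (log_natCast_nonneg _) (abs_nonneg s)
      exact log_le_log (by positivity) (Nat.cast_le.2 (Nat.factorial_le hj'.le))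
    have h₂ : K * j' ≤ K * q := by gcongr
    have h₃ : 0 ≤ |s| * log q.factorial * j := by positivity
    have h₄ : 0 ≤ K * q * j := by positivity
    rw [exp_le_exp]
    push_cast
    linarith
  have trace_to_datum : (∃ K : ℝ, 0 ≤ K ∧ ∀ j j' : ℕ, j' < q →
        ‖u j j'‖ ≤ exp (K * (j + 1) + σ * log j.factorial)) →
      ∃ K : ℝ, 0 ≤ K ∧ ∀ n : ℕ, ‖φ n‖ ≤ exp (K * (n + 1) + s * log n.factorial) := by
    rintro ⟨K, hK, h⟩
    have hq0 : 0 ≤ log (q.factorial : ℝ) := log_natCast_nonneg _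
    refine ⟨K + 2 * (|1 + s| * D) + |s| * log q.factorial, by positivity, fun n => ?_⟩
    have hlt : n % q < q := Nat.mod_lt _ hq
    have hj : n / q ≤ n := Nat.div_le_self n q
    have hr : n % q ≤ n := Nat.mod_le n q
    have hn : n % q + q * (n / q) = n := Nat.mod_add_div n q
    have hb := h (n / q) (n % q) hlt
    have hf := (abs_le.1 (hfact' (n % q) (n / q))).1
    rw [hnorm, hn, ← le_div_iff₀' (exp_pos _), ← exp_sub] at hb
    rw [hn] at hf
    generalize n % q = r at *
    generalize n / q = j at *
    refine hb.trans (exp_le_exp.2 ?_)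
    have hj : (j : ℝ) ≤ n := Nat.cast_le.2 hj
    have hr : (r : ℝ) ≤ n := Nat.cast_le.2 hr
    have h₁ : -s * log r.factorial ≤ |s| * log q.factorial := by
      refine mul_le_mul (neg_le_abs s) ?_ (log_natCast_nonneg _) (abs_nonneg s)
      exact log_le_log (by positivity) (Nat.cast_le.2 (Nat.factorial_le hlt.le))
    have h₂ : K * j ≤ K * n := by gcongr
    have h₃ : 0 ≤ |s| * log q.factorial * n := by positivity
    have h₄ : |1 + s| * D * (r + j) ≤ |1 + s| * D * (n + n) := by gcongr
    have h₅ : 0 ≤ |1 + s| * D := by positivity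
    rw [hσ]
    linarith
  exact ⟨⟨solution_to_trace ∘ datum_to_solution, trace_to_datum⟩,
    ⟨datum_to_solution ∘ trace_to_datum, solution_to_trace⟩⟩
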